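/- Let λ_1,...,λ_n be GOE eigenvalues (joint density proportional to e^{-∑λ_i²/2}∏_{i<j}|λ_i-λ_j|), and for c₀ > 0 let χ̃^{(n,2)}((0,c₀)) count pairs (i, i+2) of order statistics with n(λ_{(i+2)} - λ_{(i)}) < c₀. Then for n > 2c₀² + 2, ℙ(χ̃^{(n,2)}((0,c₀)) > 0) ≤ c₀⁴/(8n). -/

import Mathlib

open MeasureTheory

/-- The (unnormalized) GOE eigenvalue density `e^{-∑ λᵢ²/2} ∏_{i<j} |λ_i - λ_j|`. -/
noncomputable def goeDensity (n : ℕ) (lam : Fin n → ℝ) : ℝ :=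
  Real.exp (-∑ i : Fin n, lam i ^ 2 / 2) *
    ∏ p ∈ Finset.univ.filter (fun p : Fin n × Fin n => p.1 < p.2), |lam p.1 - lam p.2|

/-- The event `χ̃^{(n,2)}((0,c₀)) > 0`: some pair of order statistics two apart satisfies
`n (λ_{(i+2)} - λ_{(i)}) ∈ (0, c₀)` (the order statistics are realized by a permutation `σ`
making `λ ∘ σ` monotone). -/
def succGapEvent (n : ℕ) (c₀ : ℝ) : Set (Fin n → ℝ) :=
  {l : Fin n → ℝ | ∃ σ : Equiv.Perm (Fin n), Monotone (l ∘ σ) ∧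
    ∃ i : ℕ, ∃ h : i + 2 < n,
      (n : ℝ) * ((l ∘ σ) ⟨i + 2, h⟩ - (l ∘ σ) ⟨i, by omega⟩) ∈ Set.Ioo 0 c₀}

open Polynomial in
lemma poly_int {b : ℝ} (hb : 0 < b) (P : ℝ[X]) :
    Integrable (fun t : ℝ => P.eval t * Real.exp (-b * t ^ 2)) := by
  induction P using Polynomial.induction_on' with
  | add p q hp hq =>
    simp only [eval_add, add_mul]
    exact hp.add hq
  | monomial k a =>
    have h := (integrable_rpow_mul_exp_neg_mul_sq hb (s := (k : ℝ)) (by have : (0:ℝ) ≤ k := k.cast_nonneg; linarith)).const_mul a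
    simp only [Real.rpow_natCast] at h
    simpa [mul_assoc] using h

open Polynomial in
lemma poly_deriv (b : ℝ) (P : ℝ[X]) (t : ℝ) :
    HasDerivAt (fun t : ℝ => P.eval t * Real.exp (-b * t ^ 2))
      ((derivative P - C (2 * b) * X * P).eval t * Real.exp (-b * t ^ 2)) t := by
  have h1 := P.hasDerivAt t
  have h2 : HasDerivAt (fun t : ℝ => Real.exp (-b * t ^ 2))
      (Real.exp (-b * t ^ 2) * (-b * (2 * t))) t := by
    have := ((hasDerivAt_pow 2 t).const_mul (-b)).exp
    simpa using this
  have h3 := h1.mul h2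
  refine h3.congr_deriv ?_
  simp
  ring

open Polynomial in
lemma poly_tot {b : ℝ} (hb : 0 < b) (P : ℝ[X]) :
    ∫ t : ℝ, (derivative P - C (2 * b) * X * P).eval t * Real.exp (-b * t ^ 2) = 0 :=
  integral_eq_zero_of_hasDerivAt_of_integrable (poly_deriv b P) (poly_int hb _) (poly_int hb _)

open Polynomial in
lemma poly_Iic {b : ℝ} (hb : 0 < b) (P : ℝ[X]) (a : ℝ) :
    ∫ t in Set.Iic a, (derivative P - C (2 * b) * X * P).eval t * Real.exp (-b * t ^ 2)
      = P.eval a * Real.exp (-b * a ^ 2) := by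
  have h := tendsto_zero_of_hasDerivAt_of_integrableOn_Iic (a := a)
    (fun x _ => poly_deriv b P x) (poly_int hb _).integrableOn (poly_int hb _).integrableOn
  have := integral_Iic_of_hasDerivAt_of_tendsto (a := a)
    (poly_deriv b P a).continuousAt.continuousWithinAt (fun x _ => poly_deriv b P x)
    (poly_int hb _).integrableOn h
  simpa using this

noncomputable def sg (x : ℝ) : ℝ := ((SignType.sign x : SignType) : ℝ)

lemma sg_pos {x : ℝ} (h : 0 < x) : sg x = 1 := by simp [sg, h]
lemma sg_neg {x : ℝ} (h : x < 0) : sg x = -1 := by simp [sg, h]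
lemma sg_mul (x y : ℝ) : sg (x * y) = sg x * sg y := by simp [sg, sign_mul]
lemma sg_mul_self (x : ℝ) : sg x * x = |x| := by
  rcases lt_trichotomy x 0 with h | h | h
  · rw [sg_neg h, abs_of_neg h]; ring
  · simp [h]
  · rw [sg_pos h, abs_of_pos h]; ring
lemma sg_abs_le (x : ℝ) : |sg x| ≤ 1 := by
  rcases lt_trichotomy x 0 with h | h | h
  · rw [sg_neg h]; simp
  · simp [h, sg]
  · rw [sg_pos h]; simp
lemma sg_meas : Measurable sg := by
  have : sg = fun x => if 0 < x then (1:ℝ) else if x < 0 then -1 else 0 := by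
    funext x
    rcases lt_trichotomy x 0 with h | h | h
    · rw [sg_neg h]; simp [h, h.le]
    · simp [h, sg]
    · rw [sg_pos h]; simp [h]
  rw [this]
  refine Measurable.ite measurableSet_Ioi measurable_const ?_
  exact Measurable.ite measurableSet_Iio measurable_const measurable_const

lemma sgn_prod_eq (s : Finset ℝ) (t u : ℝ) (ht : ∀ x ∈ s, t < x) (hu : ∀ x ∈ s, u < x) :
    sg (∏ a ∈ s, (t - a)) = sg (∏ a ∈ s, (u - a)) := by
  induction s using Finset.induction_on with
  | empty => simp
  | insert a s ha ih =>
    rw [Finset.prod_insert ha, Finset.prod_insert ha, sg_mul, sg_mul,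
      ih (fun x hx => ht x (Finset.mem_insert_of_mem hx)) (fun x hx => hu x (Finset.mem_insert_of_mem hx)),
      sg_neg (sub_neg.2 (ht a (Finset.mem_insert_self _ _))),
      sg_neg (sub_neg.2 (hu a (Finset.mem_insert_self _ _)))]

lemma sgn_sum (s : Finset ℝ) (t : ℝ) (ht : t ∉ s) :
    sg (∏ a ∈ s, (t - a)) = 1 - 2 * ∑ a ∈ s, if t < a then sg (∏ b ∈ s.erase a, (a - b)) else 0 := by
  induction s using Finset.induction_on_min with
  | empty => simp [sg]
  | insert a s hs ih =>
    have ha : a ∉ s := fun h => lt_irrefl _ (hs a h)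
    have hta : t ≠ a := fun h => ht (h ▸ Finset.mem_insert_self _ _)
    have hts : t ∉ s := fun h => ht (Finset.mem_insert_of_mem h)
    have ih := ih hts
    rw [Finset.prod_insert ha, sg_mul, Finset.sum_insert ha, Finset.erase_insert ha]
    have key : ∑ x ∈ s, (if t < x then sg (∏ b ∈ (insert a s).erase x, (x - b)) else 0)
        = ∑ x ∈ s, (if t < x then sg (∏ b ∈ s.erase x, (x - b)) else 0) := by
      refine Finset.sum_congr rfl fun x hx => ?_
      have hxa : a ≠ x := (hs x hx).ne
      rw [Finset.erase_insert_of_ne hxa, Finset.prod_insert (by simp [ha]), sg_mul,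
        sg_pos (sub_pos.2 (hs x hx)), one_mul]
    rw [key]
    rcases lt_or_gt_of_ne hta with h | h
    · rw [if_pos h, sg_neg (sub_neg.2 h), sgn_prod_eq s a t hs (fun x hx => h.trans (hs x hx))]
      linarith
    · rw [if_neg h.not_gt, sg_pos (sub_pos.2 h), ih]; ring

open Polynomial in
lemma deriv_root (s : Finset ℝ) (a : ℝ) (ha : a ∈ s) :
    (derivative (∏ x ∈ s, (X - C x))).eval a = ∏ b ∈ s.erase a, (a - b) := by
  rw [← Finset.mul_prod_erase s _ ha]
  simp [eval_prod]

open Polynomial in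
lemma one_d (s : Finset ℝ) (q : ℝ[X]) (hq : q = ∏ x ∈ s, (X - C x)) :
    ∫ t : ℝ, sg (q.eval t) * (X * derivative q - derivative (derivative q)).eval t
        * Real.exp (-(1/2) * t ^ 2)
      = 2 * ∑ a ∈ s, |∏ b ∈ s.erase a, (a - b)| * Real.exp (-(1/2) * a ^ 2) := by
  set h : ℝ → ℝ := fun t => (derivative (derivative q) - C (2 * (1/2)) * X * derivative q).eval t
      * Real.exp (-(1/2) * t ^ 2) with hh
  have hb : (0:ℝ) < 1/2 := by norm_num
  have hI : Integrable h := poly_int hb _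
  have e1 : ∫ t : ℝ, sg (q.eval t) * (X * derivative q - derivative (derivative q)).eval t
        * Real.exp (-(1/2) * t ^ 2)
      = ∫ t : ℝ, (-h t + 2 * ∑ a ∈ s, sg (∏ b ∈ s.erase a, (a - b)) * (Set.Iic a).indicator h t) := by
    refine integral_congr_ae ?_
    have : ∀ᵐ t : ℝ, t ∉ (s : Set ℝ) := (s.finite_toSet.measure_zero volume) |> measure_eq_zero_iff_ae_notMem.1
    filter_upwards [this] with t ht
    have e2 : q.eval t = ∏ a ∈ s, (t - a) := by simp [hq, eval_prod]
    rw [e2, sgn_sum s t (by simpa using ht)]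
    have e3 : ∑ a ∈ s, sg (∏ b ∈ s.erase a, (a - b)) * (Set.Iic a).indicator h t
       = (∑ a ∈ s, if t < a then sg (∏ b ∈ s.erase a, (a - b)) else 0) * h t := by
      rw [Finset.sum_mul]
      refine Finset.sum_congr rfl fun a ha => ?_
      have hta : t ≠ a := fun h => ht (h ▸ ha)
      rcases lt_or_gt_of_ne hta with h' | h'
      · simp [h', h'.le]
      · simp [h', h'.not_gt]
    rw [e3]
    simp only [hh]
    simp
    ring
  rw [e1, integral_add (f := fun t => -h t) hI.neg, integral_neg, poly_tot hb, integral_const_mul, integral_finsetSum]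
  · rw [neg_zero, zero_add]
    congr 1
    refine Finset.sum_congr rfl fun a ha => ?_
    rw [integral_const_mul, integral_indicator measurableSet_Iic, poly_Iic hb, hq, deriv_root s a ha,
      ← mul_assoc, sg_mul_self]
  · intro a ha
    exact (hI.indicator measurableSet_Iic).const_mul _
  · exact (integrable_finsetSum _ fun a ha => (hI.indicator measurableSet_Iic).const_mul _).const_mul _

open Polynomial in
/-- Hermite bound -/
lemma herm (m : ℕ) (p : ℝ[X]) (hp : p.natDegree ≤ m) :
    ∫ t : ℝ, ((derivative p) ^ 2).eval t * Real.exp (-1 * t ^ 2)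
      ≤ 2 * m * ∫ t : ℝ, (p ^ 2).eval t * Real.exp (-1 * t ^ 2) := by
  have lin : ∀ (a b : ℝ) (P Q : ℝ[X]), ∫ t : ℝ, (C a * P + C b * Q).eval t * Real.exp (-1 * t ^ 2)
      = a * (∫ t : ℝ, P.eval t * Real.exp (-1 * t ^ 2)) + b * ∫ t : ℝ, Q.eval t * Real.exp (-1 * t ^ 2) := by
    intro a b P Q
    rw [← integral_const_mul, ← integral_const_mul, ← integral_add]
    · congr 1; funext t; simp; ring
    · exact (poly_int one_pos _).const_mul _
    · exact (poly_int one_pos _).const_mul _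
  induction m generalizing p with
  | zero =>
    rw [Polynomial.natDegree_eq_zero.1 (Nat.le_zero.1 hp) |>.choose_spec.symm]
    simp
  | succ m ih =>
    have h1 := ih (derivative p) ((natDegree_derivative_le p).trans (by omega))
    set p1 := derivative p with hp1
    set p2 := derivative p1 with hp2
    set M : ℝ := ((m + 1 : ℕ) : ℝ) with hM
    -- L p = p2 - 2 X p1
    have hpos : 0 ≤ ∫ t : ℝ, ((p2 - C 2 * X * p1 + C (2 * M) * p) ^ 2).eval t * Real.exp (-1 * t ^ 2) :=
      integral_nonneg fun t => mul_nonneg (by rw [eval_pow]; positivity) (Real.exp_pos _).le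
    have t1 := poly_tot one_pos (C (4 * M) * (p * p1) - C 2 * X * p1 ^ 2)
    set W := C (4 * M) * (p * p1) - C 2 * X * p1 ^ 2 with hW
    have ex : (p2 - C 2 * X * p1 + C (2 * M) * p) ^ 2 =
        C 1 * (C 1 * p2 ^ 2 + C (2 - 4 * M) * p1 ^ 2) +
        C 1 * (C (4 * M ^ 2) * p ^ 2 + C 1 * (derivative W - C (2 * 1) * X * W)) := by
      have hd : derivative W = C (4 * M) * (p1 * p1 + p * p2) - C 2 * (p1 ^ 2 + X * (2 * p1 * p2)) := by
        rw [hW]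
        simp only [derivative_sub, derivative_mul, derivative_C, derivative_X, derivative_pow, ← hp1, ← hp2]
        have hC2 : (C 2 : ℝ[X]) = 2 := map_ofNat C 2
        simp [hC2]
        ring
      rw [hd, hW]
      simp only [C_mul, C_sub, C_pow, map_ofNat, C_1]
      ring
    rw [ex, lin, lin, lin, t1] at hpos
    have hM1 : M = m + 1 := by simp [hM]
    have hMp : 0 < M := by rw [hM1]; positivity
    set A := ∫ t : ℝ, (p ^ 2).eval t * Real.exp (-1 * t ^ 2)
    set B := ∫ t : ℝ, (p1 ^ 2).eval t * Real.exp (-1 * t ^ 2)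
    have : 0 ≤ (2 * M) * (2 * M * A - B) := by
      have : (m : ℝ) = M - 1 := by linarith
      rw [this] at h1
      nlinarith
    have := nonneg_of_mul_nonneg_right this (by linarith)
    linarith

open Polynomial in
/-- Hermite-function bound on the derivative. -/
lemma herm_F (m : ℕ) (p : ℝ[X]) (hp : p.natDegree ≤ m) :
    ∫ t : ℝ, ((derivative p - X * p) ^ 2).eval t * Real.exp (-1 * t ^ 2)
      ≤ (2 * m + 1) * ∫ t : ℝ, (p ^ 2).eval t * Real.exp (-1 * t ^ 2) := by
  have h1 := herm m p hp
  have t1 := poly_tot one_pos (X * p ^ 2)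
  have hpos : 0 ≤ ∫ t : ℝ, ((X * p) ^ 2).eval t * Real.exp (-1 * t ^ 2) :=
      integral_nonneg fun t => mul_nonneg (by rw [eval_pow]; positivity) (Real.exp_pos _).le
  have e : ∫ t : ℝ, ((derivative p - X * p) ^ 2).eval t * Real.exp (-1 * t ^ 2) =
     (∫ t : ℝ, ((derivative p) ^ 2).eval t * Real.exp (-1 * t ^ 2))
     + (∫ t : ℝ, (p ^ 2).eval t * Real.exp (-1 * t ^ 2))
     - (∫ t : ℝ, (derivative (X * p ^ 2) - C (2 * 1) * X * (X * p ^ 2)).eval t * Real.exp (-1 * t ^ 2))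
     - ∫ t : ℝ, ((X * p) ^ 2).eval t * Real.exp (-1 * t ^ 2) := by
    rw [← integral_add, ← integral_sub, ← integral_sub]
    · congr 1; funext t; simp [derivative_pow]; ring
    all_goals first
      | exact poly_int one_pos _
      | exact (poly_int one_pos _).add (poly_int one_pos _)
      | exact ((poly_int one_pos _).add (poly_int one_pos _)).sub (poly_int one_pos _)
  rw [e, t1]
  linarith
open Polynomial in
lemma F_bound (p : ℝ[X]) (a x : ℝ) (hax : a < x) (ha : p.eval a = 0) :
    (p.eval x * Real.exp (-(1/2) * x ^ 2)) ^ 2 ≤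
      (x - a) * ∫ t in Set.Ioc a x, ((derivative p - X * p) ^ 2).eval t * Real.exp (-1 * t ^ 2) := by
  set F : ℝ → ℝ := fun t => p.eval t * Real.exp (-(1/2) * t ^ 2) with hF
  set F' : ℝ → ℝ := fun t => (derivative p - C (2 * (1/2)) * X * p).eval t * Real.exp (-(1/2) * t ^ 2) with hF'
  have hd : ∀ t, HasDerivAt F (F' t) t := poly_deriv (1/2) p
  have hc : Continuous F' := by
    rw [hF']; fun_prop
  have hftc : ∫ t in a..x, F' t = F x := by
    rw [intervalIntegral.integral_eq_sub_of_hasDerivAt (fun t _ => hd t) (hc.intervalIntegrable _ _)]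
    simp [hF, ha]
  have hsq : ∀ t, ((derivative p - X * p) ^ 2).eval t * Real.exp (-1 * t ^ 2) = F' t ^ 2 := by
    intro t
    have : Real.exp (-1 * t ^ 2) = Real.exp (-(1/2) * t ^ 2) ^ 2 := by
      rw [← Real.exp_nat_mul]; congr 1; push_cast; ring
    rw [this, hF']
    simp
    ring
  simp only [hsq]
  rw [← intervalIntegral.integral_of_le hax.le]
  set K := ∫ t in a..x, F' t ^ 2 with hK
  set μ := F x / (x - a) with hμ
  have hpos : 0 < x - a := sub_pos.2 hax
  have h0 : 0 ≤ ∫ t in a..x, (F' t - μ) ^ 2 :=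
    intervalIntegral.integral_nonneg hax.le fun t _ => sq_nonneg _
  have h1 : ∫ t in a..x, (F' t - μ) ^ 2 = K - 2 * μ * F x + μ ^ 2 * (x - a) := by
    have : ∀ t, (F' t - μ) ^ 2 = F' t ^ 2 - 2 * μ * F' t + μ ^ 2 := fun t => by ring
    simp only [this]
    rw [intervalIntegral.integral_add, intervalIntegral.integral_sub, intervalIntegral.integral_const_mul, hftc]
    · simp; ring
    · exact (hc.pow 2).intervalIntegrable _ _
    · exact (continuous_const.mul hc).intervalIntegrable _ _
    · exact ((hc.pow 2).sub (continuous_const.mul hc)).intervalIntegrable _ _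
    · exact continuous_const.intervalIntegrable _ _
  have h2 : μ * (x - a) = F x := by rw [hμ]; field_simp
  rw [h1] at h0
  have h3 : 0 ≤ (x - a) * (K - 2 * μ * F x + μ ^ 2 * (x - a)) := mul_nonneg hpos.le h0
  have h4 : (x - a) * (K - 2 * μ * F x + μ ^ 2 * (x - a)) = (x - a) * K - F x ^ 2 := by
    have : (x - a) * (K - 2 * μ * F x + μ ^ 2 * (x - a)) =
      (x - a) * K - 2 * (μ * (x - a)) * F x + (μ * (x - a)) ^ 2 := by ring
    rw [this, h2]; ring
  linarith

lemma tri_int (a c : ℝ) (hc : 0 < c) :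
    ∫⁻ x in Set.Ioo a (a + c), ENNReal.ofReal (a + c - x) = ENNReal.ofReal (c ^ 2 / 2) := by
  rw [← ofReal_integral_eq_lintegral_ofReal]
  · rw [← integral_Ioc_eq_integral_Ioo, ← intervalIntegral.integral_of_le (by linarith)]
    congr 1
    rw [intervalIntegral.integral_sub (by simp) (by simp)]
    simp
    ring
  · exact ((continuous_const.sub continuous_id).integrableOn_Icc (a := a) (b := a + c)).mono_set Set.Ioo_subset_Icc_self
  · refine (ae_restrict_iff' measurableSet_Ioo).2 (Filter.Eventually.of_forall fun x hx => ?_)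
    simp only [Pi.zero_apply]; linarith [hx.2]

lemma tri_lint (a c : ℝ) (hc : 0 < c) (k : ENNReal) :
    ∫⁻ x₁ : ℝ, (Set.Ioo a (a + c)).indicator (fun x₁ => ∫⁻ x₂ : ℝ, (Set.Ioo x₁ (a + c)).indicator (fun _ => k) x₂) x₁
      = k * ENNReal.ofReal (c ^ 2 / 2) := by
  rw [lintegral_indicator measurableSet_Ioo, ← tri_int a c hc, ← lintegral_const_mul _ (by fun_prop)]
  congr 1; funext x
  rw [lintegral_indicator_const measurableSet_Ioo]
  simp

open Classical in
open Polynomial in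
lemma gap_bound {m : ℕ} (lam : Fin m → ℝ) (hinj : Function.Injective lam) (c : ℝ) (hc : 0 < c) :
    ∫⁻ x₁ : ℝ, ∫⁻ x₂ : ℝ,
      (if ∃ i, lam i < x₁ ∧ x₁ < x₂ ∧ x₂ < lam i + c ∧ ∀ k, ¬ (lam i < lam k ∧ lam k < x₂) then
        ENNReal.ofReal (|x₁ - x₂| * ((∏ i, |x₁ - lam i|) * Real.exp (-(1/2) * x₁ ^ 2))
          * ((∏ i, |x₂ - lam i|) * Real.exp (-(1/2) * x₂ ^ 2))) else 0)
    ≤ ENNReal.ofReal (c ^ 4 / 4 * (2 * m + 1) * ∫ t : ℝ, (∏ i, |t - lam i|) ^ 2 * Real.exp (-1 * t ^ 2)) := by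
  set p : ℝ[X] := ∏ i, (X - C (lam i)) with hp
  have hpe : ∀ t, |p.eval t| = ∏ i, |t - lam i| := by
    intro t; rw [hp, eval_prod, Finset.abs_prod]; simp
  set f : ℝ → ℝ := fun t => ((derivative p - X * p) ^ 2).eval t * Real.exp (-1 * t ^ 2) with hf
  have hfi : Integrable f := poly_int one_pos _
  have hf0 : ∀ t, 0 ≤ f t := fun t => mul_nonneg (by rw [eval_pow]; positivity) (Real.exp_pos _).le
  set J : Fin m → Set ℝ := fun i => {x | lam i < x ∧ ∀ k, ¬ (lam i < lam k ∧ lam k < x)} with hJ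
  have hJm : ∀ i, MeasurableSet (J i) := by
    intro i
    have : J i = Set.Ioi (lam i) ∩ ⋂ k, {x | ¬ (lam i < lam k ∧ lam k < x)} := by
      ext x; simp [hJ]
    rw [this]
    refine measurableSet_Ioi.inter (MeasurableSet.iInter fun k => ?_)
    by_cases h : lam i < lam k
    · simp only [h, true_and, not_lt]; exact measurableSet_Iic
    · simp [h]
  have hJd : Pairwise (Function.onFun Disjoint J) := by
    intro i k hik
    refine Set.disjoint_left.2 fun x hx hx' => ?_
    rcases lt_or_gt_of_ne (fun h => hik (hinj h)) with h | h
    · exact hx.2 k ⟨h, hx'.1⟩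
    · exact hx'.2 i ⟨h, hx.1⟩
  set K : Fin m → ℝ := fun i => ∫ t in J i, f t with hK
  have hK0 : ∀ i, 0 ≤ K i := fun i => integral_nonneg fun t => hf0 t
  have hKs : ∑ i, K i ≤ ∫ t, f t := by
    rw [hK, ← integral_iUnion_fintype hJm hJd (fun i => hfi.integrableOn)]
    exact setIntegral_le_integral hfi (Filter.Eventually.of_forall hf0)
  have hdeg : p.natDegree ≤ m := by
    rw [hp]
    refine (natDegree_prod_le _ _).trans ?_
    simp
  have hmain := herm_F m p hdeg
  have hFb : ∀ i x, lam i < x → (∀ k, ¬ (lam i < lam k ∧ lam k < x)) →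
      ((∏ i, |x - lam i|) * Real.exp (-(1/2) * x ^ 2)) ^ 2 ≤ (x - lam i) * K i := by
    intro i x hx hk
    have h := F_bound p (lam i) x hx (by rw [hp, eval_prod]; exact Finset.prod_eq_zero (Finset.mem_univ i) (by simp))
    have h2 : (∫ t in Set.Ioc (lam i) x, f t) ≤ K i := by
      refine setIntegral_mono_set hfi.integrableOn (Filter.Eventually.of_forall hf0) ?_
      refine Filter.Eventually.of_forall fun y hy => ?_
      exact ⟨hy.1, fun k hk' => hk k ⟨hk'.1, hk'.2.trans_le hy.2⟩⟩
    rw [← hpe, mul_pow, sq_abs, ← mul_pow]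
    exact h.trans (mul_le_mul_of_nonneg_left h2 (by linarith))
  have step : ∀ x₁ x₂ : ℝ, (if ∃ i, lam i < x₁ ∧ x₁ < x₂ ∧ x₂ < lam i + c ∧ ∀ k, ¬ (lam i < lam k ∧ lam k < x₂) then
        ENNReal.ofReal (|x₁ - x₂| * ((∏ i, |x₁ - lam i|) * Real.exp (-(1/2) * x₁ ^ 2))
          * ((∏ i, |x₂ - lam i|) * Real.exp (-(1/2) * x₂ ^ 2))) else 0) ≤
      ∑ i, (Set.Ioo (lam i) (lam i + c)).indicator (fun x₁ => (Set.Ioo x₁ (lam i + c)).indicator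
        (fun _ => ENNReal.ofReal (c ^ 2 / 2 * K i)) x₂) x₁ := by
    intro x₁ x₂
    split_ifs with h
    · obtain ⟨i, h1, h2, h3, h4⟩ := h
      refine le_trans ?_ (Finset.single_le_sum (fun _ _ => zero_le) (Finset.mem_univ i))
      rw [Set.indicator_of_mem (show x₁ ∈ Set.Ioo (lam i) (lam i + c) from ⟨h1, h2.trans h3⟩), Set.indicator_of_mem (show x₂ ∈ Set.Ioo x₁ (lam i + c) from ⟨h2, h3⟩)]
      refine ENNReal.ofReal_le_ofReal ?_
      have b1 := hFb i x₁ h1 (fun k hk => h4 k ⟨hk.1, hk.2.trans h2⟩)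
      have b2 := hFb i x₂ (h1.trans h2) h4
      set A := (∏ i, |x₁ - lam i|) * Real.exp (-(1/2) * x₁ ^ 2)
      set B := (∏ i, |x₂ - lam i|) * Real.exp (-(1/2) * x₂ ^ 2)
      rw [abs_of_neg (by linarith)]
      have hAB : A * B ≤ ((x₁ - lam i) + (x₂ - lam i)) / 2 * K i := by nlinarith [sq_nonneg (A - B)]
      have hx : 0 ≤ x₂ - x₁ := by linarith
      calc -(x₁ - x₂) * A * B = (x₂ - x₁) * (A * B) := by ring
        _ ≤ (x₂ - x₁) * (((x₁ - lam i) + (x₂ - lam i)) / 2 * K i) := mul_le_mul_of_nonneg_left hAB hx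
        _ = ((x₂ - lam i) ^ 2 - (x₁ - lam i) ^ 2) / 2 * K i := by ring
        _ ≤ c ^ 2 / 2 * K i := by
          refine mul_le_mul_of_nonneg_right ?_ (hK0 i)
          nlinarith
    · exact zero_le
  have hmeas1 : ∀ i (x₁ : ℝ), Measurable fun x₂ : ℝ => (Set.Ioo (lam i) (lam i + c)).indicator (fun x₁ => (Set.Ioo x₁ (lam i + c)).indicator
        (fun _ => ENNReal.ofReal (c ^ 2 / 2 * K i)) x₂) x₁ := by
    intro i x₁
    by_cases h : x₁ ∈ Set.Ioo (lam i) (lam i + c)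
    · simp only [Set.indicator_of_mem h]; exact measurable_const.indicator measurableSet_Ioo
    · simp only [Set.indicator_of_notMem h]; exact measurable_const
  have hin : ∀ i (x₁ : ℝ), ∫⁻ x₂ : ℝ, (Set.Ioo (lam i) (lam i + c)).indicator (fun x₁ => (Set.Ioo x₁ (lam i + c)).indicator
        (fun _ => ENNReal.ofReal (c ^ 2 / 2 * K i)) x₂) x₁ =
      (Set.Ioo (lam i) (lam i + c)).indicator (fun x₁ => ∫⁻ x₂ : ℝ, (Set.Ioo x₁ (lam i + c)).indicator
        (fun _ => ENNReal.ofReal (c ^ 2 / 2 * K i)) x₂) x₁ := by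
    intro i x₁
    by_cases h : x₁ ∈ Set.Ioo (lam i) (lam i + c)
    · simp only [Set.indicator_of_mem h]
    · simp only [Set.indicator_of_notMem h]; simp
  calc _ ≤ ∫⁻ x₁ : ℝ, ∫⁻ x₂ : ℝ, ∑ i, (Set.Ioo (lam i) (lam i + c)).indicator (fun x₁ => (Set.Ioo x₁ (lam i + c)).indicator
        (fun _ => ENNReal.ofReal (c ^ 2 / 2 * K i)) x₂) x₁ :=
        lintegral_mono fun x₁ => lintegral_mono fun x₂ => step x₁ x₂
    _ = ∑ i, ENNReal.ofReal (c ^ 2 / 2 * K i) * ENNReal.ofReal (c ^ 2 / 2) := by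
        simp_rw [lintegral_finsetSum _ (fun i _ => hmeas1 i _), hin]
        rw [lintegral_finsetSum]
        · simp_rw [tri_lint _ c hc]
        · intro i _
          refine Measurable.indicator ?_ measurableSet_Ioo
          simp_rw [lintegral_indicator_const measurableSet_Ioo, Real.volume_Ioo]
          fun_prop
    _ = ENNReal.ofReal (∑ i, c ^ 2 / 2 * K i * (c ^ 2 / 2)) := by
        rw [ENNReal.ofReal_sum_of_nonneg]
        · refine Finset.sum_congr rfl fun i _ => ?_
          rw [ENNReal.ofReal_mul (mul_nonneg (by positivity) (hK0 i))]
        · intro i _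
          exact mul_nonneg (mul_nonneg (by positivity) (hK0 i)) (by positivity)
    _ ≤ _ := by
        refine ENNReal.ofReal_le_ofReal ?_
        have e1 : ∑ i, c ^ 2 / 2 * K i * (c ^ 2 / 2) = c ^ 4 / 4 * ∑ i, K i := by
          rw [Finset.mul_sum]; refine Finset.sum_congr rfl fun i _ => ?_; ring
        have e2 : ∫ t : ℝ, (∏ i, |t - lam i|) ^ 2 * Real.exp (-1 * t ^ 2) =
            ∫ t : ℝ, (p ^ 2).eval t * Real.exp (-1 * t ^ 2) := by
          congr 1; funext t; rw [← hpe, sq_abs, eval_pow]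
        rw [e1, e2, mul_assoc]
        exact mul_le_mul_of_nonneg_left (hKs.trans hmain) (by positivity)
lemma goe_insert {n : ℕ} (i : Fin (n + 1)) (t : ℝ) (l : Fin n → ℝ) :
    goeDensity (n + 1) (i.insertNth t l : Fin (n + 1) → ℝ) =
      Real.exp (-(1/2) * t ^ 2) * (∏ j, |t - l j|) * goeDensity n l := by
  have hD : ∀ {k : ℕ} (l : Fin k → ℝ),
      ∏ p ∈ Finset.univ.filter (fun p : Fin k × Fin k => p.1 < p.2), |l p.1 - l p.2|
        = ∏ a, ∏ b, if a < b then |l a - l b| else 1 := by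
    intro k l
    rw [Finset.prod_filter, ← Finset.univ_product_univ, Finset.prod_product]
  unfold goeDensity
  rw [hD, hD, Fin.prod_univ_succAbove _ i, Fin.prod_univ_succAbove _ i]
  simp_rw [Fin.prod_univ_succAbove (fun b => if (i.succAbove _) < b then |(i.insertNth t l : Fin (n + 1) → ℝ) (i.succAbove _) - (i.insertNth t l : Fin (n + 1) → ℝ) b| else 1) i]
  rw [Finset.prod_mul_distrib]
  simp only [Fin.insertNth_apply_same, Fin.insertNth_apply_succAbove, lt_irrefl, if_false, one_mul,
    Fin.succAbove_lt_succAbove_iff]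
  rw [← mul_assoc (∏ j, _), ← Finset.prod_mul_distrib]
  have e : ∀ j, ((if i < i.succAbove j then |t - l j| else 1) * if i.succAbove j < i then |l j - t| else 1) = |t - l j| := by
    intro j
    rcases lt_or_gt_of_ne (Fin.succAbove_ne i j) with h | h
    · rw [if_neg h.not_gt, if_pos h, one_mul, abs_sub_comm]
    · rw [if_pos h, if_neg h.not_gt, mul_one]
  simp_rw [e]
  rw [Fin.sum_univ_succAbove _ i]
  simp only [Fin.insertNth_apply_same, Fin.insertNth_apply_succAbove]
  rw [neg_add, Real.exp_add, show -(t ^ 2 / 2) = -(1/2) * t ^ 2 by ring]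
  ring

lemma goe_zero {n : ℕ} (l : Fin n → ℝ) (h : ¬ Function.Injective l) : goeDensity n l = 0 := by
  simp only [Function.Injective, not_forall] at h
  obtain ⟨a, b, hab, hne⟩ := h
  unfold goeDensity
  rcases lt_or_gt_of_ne hne with h | h
  · rw [Finset.prod_eq_zero (i := (a, b)) (by simp [h]) (by simp [hab]), mul_zero]
  · rw [Finset.prod_eq_zero (i := (b, a)) (by simp [h]) (by simp [hab]), mul_zero]

lemma goe_nonneg {n : ℕ} (l : Fin n → ℝ) : 0 ≤ goeDensity n l :=
  mul_nonneg (Real.exp_pos _).le (Finset.prod_nonneg fun _ _ => abs_nonneg _)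

lemma goe_cont (n : ℕ) : Continuous (goeDensity n) := by
  unfold goeDensity; fun_prop

lemma pi_mp {n : ℕ} (i : Fin (n + 1)) :
    MeasurePreserving (MeasurableEquiv.piFinSuccAbove (fun _ : Fin (n + 1) => ℝ) i).symm :=
  (volume_preserving_piFinSuccAbove (fun _ : Fin (n + 1) => ℝ) i).symm _

lemma pi_integral {n : ℕ} (i : Fin (n + 1)) (f : (Fin (n + 1) → ℝ) → ℝ) :
    ∫ l, f l = ∫ z : ℝ × (Fin n → ℝ), f (i.insertNth z.1 z.2 : Fin (n + 1) → ℝ) :=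
  ((pi_mp i).integral_comp' f).symm

lemma pi_lintegral {n : ℕ} (i : Fin (n + 1)) (f : (Fin (n + 1) → ℝ) → ENNReal) :
    ∫⁻ l, f l = ∫⁻ z : ℝ × (Fin n → ℝ), f (i.insertNth z.1 z.2 : Fin (n + 1) → ℝ) :=
  ((pi_mp i).lintegral_comp_emb (MeasurableEquiv.measurableEmbedding _) f).symm

lemma pi_integrable {n : ℕ} (i : Fin (n + 1)) {f : (Fin (n + 1) → ℝ) → ℝ} (hf : Integrable f) :
    Integrable (fun z : ℝ × (Fin n → ℝ) => f (i.insertNth z.1 z.2 : Fin (n + 1) → ℝ)) :=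
  (pi_mp i).integrable_comp_emb (MeasurableEquiv.measurableEmbedding _) |>.2 hf

lemma mv_int {n : ℕ} (P : MvPolynomial (Fin n) ℝ) :
    Integrable (fun l : Fin n → ℝ => MvPolynomial.eval l P * Real.exp (-∑ i, l i ^ 2 / 2)) := by
  have : (fun l : Fin n → ℝ => MvPolynomial.eval l P * Real.exp (-∑ i, l i ^ 2 / 2)) =
      fun l => ∑ d ∈ P.support, MvPolynomial.coeff d P * ∏ i, (l i ^ d i * Real.exp (-(1/2) * l i ^ 2)) := by
    funext l
    rw [MvPolynomial.eval_eq', Finset.sum_mul]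
    refine Finset.sum_congr rfl fun d _ => ?_
    rw [Finset.prod_mul_distrib, ← Real.exp_sum, mul_assoc, ← Finset.sum_neg_distrib]
    congr 4; funext i; ring
  rw [this]
  refine integrable_finsetSum _ fun d _ => Integrable.const_mul ?_ _
  refine Integrable.fintype_prod (f := fun i (x : ℝ) => x ^ d i * Real.exp (-(1/2) * x ^ 2)) fun i => ?_
  have := poly_int (b := 1/2) (by norm_num) (Polynomial.X ^ d i)
  simpa using this

noncomputable def vdmP (n : ℕ) : MvPolynomial (Fin n) ℝ :=
  ∏ p ∈ Finset.univ.filter (fun p : Fin n × Fin n => p.1 < p.2), (MvPolynomial.X p.1 - MvPolynomial.X p.2)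

lemma goe_eq {n : ℕ} (l : Fin n → ℝ) :
    goeDensity n l = |MvPolynomial.eval l (vdmP n)| * Real.exp (-∑ i, l i ^ 2 / 2) := by
  unfold goeDensity vdmP
  rw [map_prod, Finset.abs_prod, mul_comm]
  simp

lemma goe_int (n : ℕ) : Integrable (goeDensity n) := by
  refine (mv_int (vdmP n)).mono (goe_cont n).aestronglyMeasurable (Filter.Eventually.of_forall fun l => ?_)
  rw [goe_eq]; simp

open Polynomial in
noncomputable def qq {n : ℕ} (μ : Fin n → ℝ) : ℝ[X] := ∏ j, (X - C (μ j))

open Polynomial in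
noncomputable def TT {n : ℕ} (t : ℝ) (μ : Fin n → ℝ) : ℝ :=
  goeDensity n μ * (sg ((qq μ).eval t) * (X * derivative (qq μ) - derivative (derivative (qq μ))).eval t
        * Real.exp (-(1/2) * t ^ 2))

lemma vdm_remove {n : ℕ} (i : Fin (n + 1)) (l : Fin (n + 1) → ℝ) :
    goeDensity n (fun j => l (i.succAbove j)) * Real.exp (-(1/2) * l i ^ 2) =
     |MvPolynomial.eval l (MvPolynomial.rename i.succAbove (vdmP n))| * Real.exp (-∑ i, l i ^ 2 / 2) := by
  rw [goe_eq, MvPolynomial.eval_rename, Fin.sum_univ_succAbove _ i, neg_add, Real.exp_add,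
    show -(l i ^ 2 / 2) = -(1/2) * l i ^ 2 by ring]
  simp only [Function.comp_def]
  ring

open Polynomial in
lemma TT_int {n : ℕ} (i : Fin (n + 1)) :
    Integrable (fun l : Fin (n + 1) → ℝ => TT (l i) (fun j => l (i.succAbove j))) := by
  set Q : (MvPolynomial (Fin (n + 1)) ℝ)[X] := ∏ j, (X - C (MvPolynomial.X (i.succAbove j))) with hQ
  have hmap : ∀ l : Fin (n + 1) → ℝ, Q.map (MvPolynomial.eval l) = qq (fun j => l (i.succAbove j)) := by
    intro l; simp [hQ, qq, Polynomial.map_prod]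
  have hev : ∀ (R : (MvPolynomial (Fin (n + 1)) ℝ)[X]) (l : Fin (n + 1) → ℝ),
      (R.map (MvPolynomial.eval l)).eval (l i) = MvPolynomial.eval l (R.eval (MvPolynomial.X i)) := by
    intro R l
    rw [Polynomial.eval_map, ← Polynomial.eval₂_hom]
    simp
  set P0 := Q.eval (MvPolynomial.X i)
  set P1 := (X * derivative Q - derivative (derivative Q)).eval (MvPolynomial.X i)
  set P2 := MvPolynomial.rename i.succAbove (vdmP n)
  have hT : ∀ l : Fin (n + 1) → ℝ, TT (l i) (fun j => l (i.succAbove j)) =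
      sg (MvPolynomial.eval l P0) * (MvPolynomial.eval l P1 * (|MvPolynomial.eval l P2| * Real.exp (-∑ i, l i ^ 2 / 2))) := by
    intro l
    rw [← vdm_remove, ← hev, ← hev]
    unfold TT
    rw [← hmap]
    simp only [Polynomial.map_sub, Polynomial.map_mul, Polynomial.map_X, Polynomial.derivative_map]
    ring
  simp_rw [hT]
  have hm := mv_int (P1 * P2)
  refine hm.mono ?_ (Filter.Eventually.of_forall fun l => ?_)
  · refine Measurable.aestronglyMeasurable ?_
    have c0 := MvPolynomial.continuous_eval P0
    have c1 := MvPolynomial.continuous_eval P1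
    have c2 := MvPolynomial.continuous_eval P2
    refine (sg_meas.comp c0.measurable).mul (c1.measurable.mul ?_)
    exact (Continuous.mul c2.abs (by fun_prop)).measurable
  · simp only [norm_mul, Real.norm_eq_abs, abs_abs, map_mul]
    calc _ ≤ 1 * (|MvPolynomial.eval l P1| * (|MvPolynomial.eval l P2| * |Real.exp (-∑ i, l i ^ 2 / 2)|)) :=
          mul_le_mul_of_nonneg_right (sg_abs_le _) (by positivity)
      _ = _ := by ring

noncomputable def SS {m : ℕ} (a : Fin (m + 1)) (μ : Fin (m + 1) → ℝ) : ℝ :=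
  goeDensity (m + 1) μ * ((∏ j, |μ a - μ (a.succAbove j)|) * Real.exp (-(1/2) * μ a ^ 2))

lemma SS_int {m : ℕ} (a : Fin (m + 1)) : Integrable (SS a) := by
  set P : MvPolynomial (Fin (m + 1)) ℝ := ∏ j, (MvPolynomial.X a - MvPolynomial.X (a.succAbove j)) with hP
  have hPe : ∀ μ : Fin (m + 1) → ℝ, ∏ j, |μ a - μ (a.succAbove j)| = |MvPolynomial.eval μ P| := by
    intro μ; rw [hP, map_prod, Finset.abs_prod]; simp
  refine (mv_int (vdmP (m + 1) * P)).mono ?_ (Filter.Eventually.of_forall fun μ => ?_)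
  · refine Continuous.aestronglyMeasurable ?_
    unfold SS
    exact (goe_cont _).mul (by fun_prop)
  · unfold SS
    rw [hPe, goe_eq]
    simp only [norm_mul, Real.norm_eq_abs, abs_abs, map_mul, Real.abs_exp]
    have : Real.exp (-(1/2) * μ a ^ 2) ≤ 1 := Real.exp_le_one_iff.2 (by nlinarith [sq_nonneg (μ a)])
    calc _ ≤ |MvPolynomial.eval μ (vdmP (m + 1))| * Real.exp (-∑ i, μ i ^ 2 / 2) * (|MvPolynomial.eval μ P| * 1) := by
          gcongr
      _ = _ := by ring

/-- integrand of `G_{m,1}` -/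
noncomputable def gg (m : ℕ) (z : ℝ × (Fin m → ℝ)) : ℝ :=
  goeDensity m z.2 * ((∏ j, |z.1 - z.2 j|) ^ 2 * Real.exp (-1 * z.1 ^ 2))

lemma SS_gg {m : ℕ} (a : Fin (m + 1)) (z : ℝ × (Fin m → ℝ)) :
    SS a (a.insertNth z.1 z.2 : Fin (m + 1) → ℝ) = gg m z := by
  unfold SS gg
  rw [goe_insert]
  simp only [Fin.insertNth_apply_same, Fin.insertNth_apply_succAbove]
  rw [show Real.exp (-1 * z.1 ^ 2) = Real.exp (-(1/2) * z.1 ^ 2) * Real.exp (-(1/2) * z.1 ^ 2) by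
    rw [← Real.exp_add]; congr 1; ring]
  ring

lemma gg_int (m : ℕ) : Integrable (gg m) := by
  have := pi_integrable 0 (SS_int (0 : Fin (m + 1)))
  simpa only [SS_gg] using this

lemma SS_integral {m : ℕ} (a : Fin (m + 1)) : ∫ μ, SS a μ = ∫ z, gg m z := by
  rw [pi_integral a]; simp only [SS_gg]

lemma TT_inner {m : ℕ} (μ : Fin (m + 1) → ℝ) :
    ∫ t, TT t μ = 2 * ∑ a, SS a μ := by
  unfold TT SS
  rw [integral_const_mul, ← Finset.mul_sum]
  by_cases h : Function.Injective μ
  · have hq : qq μ = ∏ x ∈ Finset.univ.image μ, (Polynomial.X - Polynomial.C x) := by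
      rw [Finset.prod_image (fun a _ b _ hab => h hab)]; rfl
    rw [one_d _ _ hq, Finset.sum_image (fun a _ b _ hab => h hab)]
    have : ∀ a, |∏ b ∈ (Finset.univ.image μ).erase (μ a), (μ a - b)| = ∏ j, |μ a - μ (a.succAbove j)| := by
      intro a
      have e : (Finset.univ.image μ).erase (μ a) = Finset.univ.image (fun j => μ (a.succAbove j)) := by
        ext x
        simp only [Finset.mem_erase, Finset.mem_image, Finset.mem_univ, true_and]
        constructor
        · rintro ⟨hx, b, rfl⟩
          obtain ⟨j, rfl⟩ := Fin.exists_succAbove_eq (show b ≠ a from fun hb => hx (by rw [hb]))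
          exact ⟨j, rfl⟩
        · rintro ⟨j, rfl⟩
          exact ⟨fun hh => Fin.succAbove_ne a j (h hh), _, rfl⟩
      rw [e, Finset.prod_image (fun x _ y _ hxy => Fin.succAbove_right_injective (h hxy)), Finset.abs_prod]
    simp_rw [this]
    ring
  · rw [goe_zero μ h]; simp

lemma TT_integral {m : ℕ} (i : Fin (m + 2)) :
    ∫ l : Fin (m + 2) → ℝ, TT (l i) (fun j => l (i.succAbove j)) = 2 * (m + 1) * ∫ z, gg m z := by
  have hint := pi_integrable i (TT_int i)
  rw [pi_integral i]
  simp only [Fin.insertNth_apply_same, Fin.insertNth_apply_succAbove] at hint ⊢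
  rw [Measure.volume_eq_prod, integral_prod_symm _ hint]
  simp only [TT_inner]
  rw [integral_const_mul, integral_finsetSum _ (fun a _ => SS_int a)]
  simp only [SS_integral]
  simp
  ring

open Polynomial in
lemma q_derivs {ι : Type*} (s : Finset ι) (μ : ι → ℝ) (t : ℝ) (h : ∀ j ∈ s, t ≠ μ j) :
    (derivative (∏ j ∈ s, (X - C (μ j)))).eval t = (∏ j ∈ s, (X - C (μ j))).eval t * ∑ j ∈ s, (t - μ j)⁻¹ ∧
    (derivative (derivative (∏ j ∈ s, (X - C (μ j))))).eval t = (∏ j ∈ s, (X - C (μ j))).eval t *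
      ((∑ j ∈ s, (t - μ j)⁻¹) ^ 2 - ∑ j ∈ s, ((t - μ j)⁻¹) ^ 2) := by
  classical
  induction s using Finset.induction_on with
  | empty => simp
  | insert a s ha ih =>
    obtain ⟨h1, h2⟩ := ih (fun j hj => h j (Finset.mem_insert_of_mem hj))
    have hne : t - μ a ≠ 0 := sub_ne_zero.2 (h a (Finset.mem_insert_self _ _))
    rw [Finset.prod_insert ha, Finset.sum_insert ha, Finset.sum_insert ha]
    simp only [derivative_mul, derivative_sub, derivative_X, derivative_C, derivative_add, eval_add, eval_mul, eval_sub, eval_X, eval_C, h1, h2, sub_zero, one_mul]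
    constructor
    · field_simp
    · field_simp; ring

lemma cyc (n : ℕ) (l : Fin n → ℝ) (h : Function.Injective l) :
    ∑ i, ((∑ j, (l i - l j)⁻¹) ^ 2 - ∑ j, ((l i - l j)⁻¹) ^ 2) = 0 := by
  set a : Fin n → Fin n → ℝ := fun i j => (l i - l j)⁻¹ with ha
  have hself : ∀ i, a i i = 0 := by intro i; simp [ha]
  have hanti : ∀ i j, a i j = - a j i := by
    intro i j; simp only [ha]; rw [← inv_neg, neg_sub]
  have key : ∀ i j k, a i j * a i k + a j k * a j i + a k i * a k j =
      (if i = j then a i k ^ 2 else 0) + (if j = k then a j i ^ 2 else 0) + (if k = i then a k j ^ 2 else 0) := by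
    intro i j k
    by_cases hij : i = j
    · subst hij
      by_cases hik : i = k
      · subst hik; simp [hself]
      · simp [hself, hik, Ne.symm hik]; rw [hanti k i]; ring
    · by_cases hjk : j = k
      · subst hjk; simp [hself, hij, Ne.symm hij]; rw [hanti i j]; ring
      · by_cases hki : k = i
        · subst hki; simp [hself, hij, hjk]; rw [hanti j k]; ring
        · simp only [hij, hjk, hki, if_false, ha]
          have h1 : l i - l j ≠ 0 := sub_ne_zero.2 fun e => hij (h e)
          have h2 : l j - l k ≠ 0 := sub_ne_zero.2 fun e => hjk (h e)
          have h3 : l k - l i ≠ 0 := sub_ne_zero.2 fun e => hki (h e)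
          have h1' : l j - l i ≠ 0 := sub_ne_zero.2 fun e => hij (h e.symm)
          have h2' : l k - l j ≠ 0 := sub_ne_zero.2 fun e => hjk (h e.symm)
          have h3' : l i - l k ≠ 0 := sub_ne_zero.2 fun e => hki (h e.symm)
          field_simp
          ring
  have hsum : ∑ i, ∑ j, ∑ k, (a i j * a i k + a j k * a j i + a k i * a k j) =
      ∑ i, ∑ j, ∑ k, ((if i = j then a i k ^ 2 else 0) + (if j = k then a j i ^ 2 else 0) + (if k = i then a k j ^ 2 else 0)) := by
    simp_rw [key]
  simp only [Finset.sum_add_distrib] at hsum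
  have e1 : ∑ i, ∑ j, ∑ k, a i j * a i k = ∑ i, (∑ j, a i j) ^ 2 := by
    refine Finset.sum_congr rfl fun i _ => ?_
    rw [sq, Finset.sum_mul_sum]
  have e2 : ∑ i, ∑ j, ∑ k, a j k * a j i = ∑ i, (∑ j, a i j) ^ 2 := by
    rw [Finset.sum_comm]
    refine Finset.sum_congr rfl fun i _ => ?_
    rw [sq, Finset.sum_mul_sum]
    exact Finset.sum_congr rfl fun j _ => Finset.sum_congr rfl fun k _ => mul_comm _ _
  have e3 : ∑ i, ∑ j, ∑ k, a k i * a k j = ∑ i, (∑ j, a i j) ^ 2 := by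
    have : ∀ i, ∑ j, ∑ k, a k i * a k j = ∑ k, ∑ j, a k i * a k j := fun i => Finset.sum_comm
    simp_rw [this]
    rw [Finset.sum_comm]
    refine Finset.sum_congr rfl fun i _ => ?_
    rw [sq, Finset.sum_mul_sum]
  have f1 : ∑ i, ∑ j, ∑ k, (if i = j then a i k ^ 2 else 0) = ∑ i, ∑ j, a i j ^ 2 := by
    refine Finset.sum_congr rfl fun i _ => ?_
    rw [Finset.sum_comm]; simp
  have f2 : ∑ i, ∑ j, ∑ k, (if j = k then a j i ^ 2 else 0) = ∑ i, ∑ j, a i j ^ 2 := by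
    rw [Finset.sum_comm]; simp
  have f3 : ∑ i, ∑ j, ∑ k, (if k = i then a k j ^ 2 else 0) = ∑ i, ∑ j, a i j ^ 2 := by
    simp
  rw [e1, e2, e3, f1, f2, f3] at hsum
  rw [Finset.sum_sub_distrib]
  linarith

lemma euler (n : ℕ) (l : Fin (n + 1) → ℝ) (h : Function.Injective l) :
    ∑ i, l i * ∑ j, (l i - l j)⁻¹ = (n + 1) * n / 2 := by
  have e1 : ∑ i, l i * ∑ j, (l i - l j)⁻¹ = ∑ i, ∑ j, l i * (l i - l j)⁻¹ := by simp_rw [Finset.mul_sum]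
  have e2 : ∑ i, ∑ j, l i * (l i - l j)⁻¹ = ∑ i, ∑ j, l j * (l j - l i)⁻¹ := Finset.sum_comm
  have e3 : ∑ i, ∑ j, (l i * (l i - l j)⁻¹ + l j * (l j - l i)⁻¹) = ∑ i : Fin (n + 1), ∑ j : Fin (n + 1), (if i = j then (0:ℝ) else 1) := by
    refine Finset.sum_congr rfl fun i _ => Finset.sum_congr rfl fun j _ => ?_
    by_cases hij : i = j
    · simp [hij]
    · rw [if_neg hij]
      have h1 : l i - l j ≠ 0 := sub_ne_zero.2 fun e => hij (h e)
      have h1' : l j - l i ≠ 0 := sub_ne_zero.2 fun e => hij (h e.symm)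
      field_simp
      ring
  have e4 : ∑ i : Fin (n + 1), ∑ j : Fin (n + 1), (if i = j then (0:ℝ) else 1) = (n + 1) * n := by
    have : ∀ i j : Fin (n + 1), (if i = j then (0:ℝ) else 1) = 1 - if i = j then 1 else 0 := by
      intro i j; split_ifs <;> simp
    simp_rw [this, Finset.sum_sub_distrib]
    simp
  simp only [Finset.sum_add_distrib] at e3
  rw [e4] at e3
  linarith

lemma TT_sum {n : ℕ} (l : Fin (n + 1) → ℝ) :
    ∑ i, TT (l i) (fun j => l (i.succAbove j)) = (n + 1) * n / 2 * goeDensity (n + 1) l := by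
  by_cases h : Function.Injective l
  · have : ∀ i, TT (l i) (fun j => l (i.succAbove j)) = goeDensity (n + 1) l *
        (l i * (∑ j, (l i - l j)⁻¹) - ((∑ j, (l i - l j)⁻¹) ^ 2 - ∑ j, ((l i - l j)⁻¹) ^ 2)) := by
      intro i
      have hg : goeDensity (n + 1) l = Real.exp (-(1/2) * l i ^ 2) * |(qq (fun j => l (i.succAbove j))).eval (l i)| * goeDensity n (fun j => l (i.succAbove j)) := by
        conv_lhs => rw [← Fin.insertNth_self_removeNth i l]
        rw [goe_insert]
        simp [qq, Polynomial.eval_prod, Finset.abs_prod, Fin.removeNth]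
        left; rfl
      obtain ⟨d1, d2⟩ := q_derivs Finset.univ (fun j => l (i.succAbove j)) (l i)
        (fun j _ e => Fin.succAbove_ne i j (h e).symm)
      have s1 : ∑ j, (l i - l j)⁻¹ = ∑ j, (l i - l (i.succAbove j))⁻¹ := by
        rw [Fin.sum_univ_succAbove _ i]; simp
      have s2 : ∑ j, ((l i - l j)⁻¹) ^ 2 = ∑ j, ((l i - l (i.succAbove j))⁻¹) ^ 2 := by
        rw [Fin.sum_univ_succAbove _ i]; simp
      rw [hg, s1, s2, ← sg_mul_self]
      unfold TT
      rw [Polynomial.eval_sub, Polynomial.eval_mul, Polynomial.eval_X]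
      change _ = Polynomial.eval _ (qq _) * _ at d1
      change _ = Polynomial.eval _ (qq _) * _ at d2
      unfold qq at *
      rw [d1, d2]
      ring
    simp_rw [this]
    rw [← Finset.mul_sum, Finset.sum_sub_distrib, cyc _ l h, euler n l h]
    ring
  · rw [goe_zero l h, mul_zero]
    simp only [Function.Injective, not_forall] at h
    obtain ⟨a, b, hab, hne⟩ := h
    refine Finset.sum_eq_zero fun i _ => ?_
    unfold TT
    by_cases hi : ∃ j, l (i.succAbove j) = l i
    · obtain ⟨j, hj⟩ := hi
      have : (qq (fun j => l (i.succAbove j))).eval (l i) = 0 := by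
        rw [qq, Polynomial.eval_prod]
        exact Finset.prod_eq_zero (Finset.mem_univ j) (by simp [hj])
      rw [this]; simp [sg]
    · push Not at hi
      rw [goe_zero, zero_mul]
      intro hinj
      have hai : a ≠ i := by
        rintro rfl
        obtain ⟨j, rfl⟩ := Fin.exists_succAbove_eq (Ne.symm hne)
        exact hi j hab.symm
      have hbi : b ≠ i := by
        rintro rfl
        obtain ⟨j, rfl⟩ := Fin.exists_succAbove_eq hne
        exact hi j hab
      obtain ⟨j, rfl⟩ := Fin.exists_succAbove_eq hai
      obtain ⟨k, rfl⟩ := Fin.exists_succAbove_eq hbi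
      exact hne (congrArg _ (hinj hab))

/-- `G_{n-2,1} = G_n / 4` -/
lemma G_identity (m : ℕ) : ∫ z, gg m z = (∫ l, goeDensity (m + 2) l) / 4 := by
  have h1 : ∫ l : Fin (m + 2) → ℝ, ∑ i, TT (l i) (fun j => l (i.succAbove j)) =
      ∑ i : Fin (m + 2), 2 * (m + 1) * ∫ z, gg m z := by
    rw [integral_finsetSum _ (fun i _ => TT_int i)]
    simp_rw [TT_integral]
  simp_rw [TT_sum] at h1
  rw [integral_const_mul] at h1
  simp at h1
  have hm : (0:ℝ) < (m + 1) * (m + 2) := by positivity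
  have : ((m:ℝ) + 1) * (m + 2) * (4 * ∫ z, gg m z) = (m + 1) * (m + 2) * ∫ l, goeDensity (m + 2) l := by
    linear_combination (-2) * h1
  have := mul_left_cancel₀ hm.ne' this
  linarith
lemma pi_lintegral_le {n : ℕ} (i : Fin (n + 1)) (f : (Fin (n + 1) → ℝ) → ENNReal) :
    ∫⁻ l, f l ≤ ∫⁻ μ : Fin n → ℝ, ∫⁻ t : ℝ, f (i.insertNth t μ : Fin (n + 1) → ℝ) := by
  rw [pi_lintegral i, Measure.volume_eq_prod, ← lintegral_prod_swap]
  exact lintegral_prod_le _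

def gapCond {m : ℕ} (c : ℝ) (lam : Fin m → ℝ) (x₁ x₂ : ℝ) : Prop :=
  ∃ i, lam i < x₁ ∧ x₁ < x₂ ∧ x₂ < lam i + c ∧ ∀ k, ¬ (lam i < lam k ∧ lam k < x₂)

def EV {m : ℕ} (c : ℝ) (j : Fin (m + 2)) (k : Fin (m + 1)) : Set (Fin (m + 2) → ℝ) :=
  {l | gapCond c (fun i => l (j.succAbove (k.succAbove i))) (l (j.succAbove k)) (l j)}

lemma EV_meas {m : ℕ} (c : ℝ) (j : Fin (m + 2)) (k : Fin (m + 1)) : MeasurableSet (EV c j k) := by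
  unfold EV gapCond
  simp only [Set.setOf_exists, Set.setOf_and, Set.setOf_forall]
  refine MeasurableSet.iUnion fun i => ?_
  refine (measurableSet_lt (by fun_prop) (by fun_prop)).inter ((measurableSet_lt (by fun_prop) (by fun_prop)).inter
    ((measurableSet_lt (by fun_prop) (by fun_prop)).inter (MeasurableSet.iInter fun r => ?_)))
  have A : MeasurableSet ({l : Fin (m+2) → ℝ | l (j.succAbove (k.succAbove i)) < l (j.succAbove (k.succAbove r))} ∩
      {l | l (j.succAbove (k.succAbove r)) < l j}) :=
    (measurableSet_lt (by fun_prop) (by fun_prop)).inter (measurableSet_lt (by fun_prop) (by fun_prop))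
  exact A.compl

lemma cover {m : ℕ} (c₀ : ℝ) (l : Fin (m + 2) → ℝ) (hl : Function.Injective l)
    (h : l ∈ succGapEvent (m + 2) c₀) : ∃ j k, l ∈ EV (c₀ / ((m + 2 : ℕ) : ℝ)) j k := by
  obtain ⟨σ, hmono, i, hi, h1, h2⟩ := h
  have hst : StrictMono (l ∘ σ) := hmono.strictMono_of_injective (hl.comp σ.injective)
  have hn : (0:ℝ) < ((m + 2 : ℕ) : ℝ) := by positivity
  set r0 : Fin (m + 2) := ⟨i, by omega⟩ with hr0
  set r1 : Fin (m + 2) := ⟨i + 1, by omega⟩ with hr1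
  set r2 : Fin (m + 2) := ⟨i + 2, hi⟩ with hr2
  have h01 : r0 < r1 := by simp [hr0, hr1]
  have h12 : r1 < r2 := by simp [hr1, hr2]
  obtain ⟨k, hk⟩ := Fin.exists_succAbove_eq (show σ r1 ≠ σ r2 from fun e => h12.ne (σ.injective e))
  obtain ⟨a', ha'⟩ := Fin.exists_succAbove_eq (show σ r0 ≠ σ r2 from fun e => (h01.trans h12).ne (σ.injective e))
  obtain ⟨a, ha⟩ := Fin.exists_succAbove_eq (show a' ≠ k from fun e => h01.ne (σ.injective (by rw [← hk, ← ha', e])))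
  refine ⟨σ r2, k, a, ?_⟩
  simp only
  rw [ha, ha', hk]
  refine ⟨hst h01, hst h12, ?_, ?_⟩
  · have : l (σ r2) - l (σ r0) < c₀ / ((m + 2 : ℕ) : ℝ) := by
      rw [lt_div_iff₀ hn, mul_comm]; exact h2
    linarith
  · rintro b ⟨hb1, hb2⟩
    obtain ⟨r, hr⟩ := σ.surjective ((σ r2).succAbove (k.succAbove b))
    rw [← hr] at hb1 hb2
    have q1 : r0 < r := hst.lt_iff_lt.1 hb1
    have q2 : r < r2 := hst.lt_iff_lt.1 hb2
    have : r = r1 := by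
      rw [Fin.lt_def] at q1 q2
      ext; simp only [hr0, hr1, hr2] at *; omega
    rw [this, ← hk] at hr
    exact Fin.succAbove_ne k b (Fin.succAbove_right_injective hr).symm

open Classical in
lemma EV_lint {m : ℕ} (c : ℝ) (hc : 0 < c) (j : Fin (m + 2)) (k : Fin (m + 1)) :
    ∫⁻ l in EV c j k, ENNReal.ofReal (goeDensity (m + 2) l) ≤
      ENNReal.ofReal (c ^ 4 / 4 * (2 * m + 1) * ∫ z, gg m z) := by
  rw [← lintegral_indicator (EV_meas c j k)]
  refine (pi_lintegral_le j _).trans ?_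
  refine (pi_lintegral_le k _).trans ?_
  have hC : 0 ≤ c ^ 4 / 4 * (2 * (m:ℝ) + 1) := by positivity
  have hG : ∀ lam : Fin m → ℝ, ∫ t, gg m (t, lam) =
      goeDensity m lam * ∫ t : ℝ, (∏ i, |t - lam i|) ^ 2 * Real.exp (-1 * t ^ 2) := by
    intro lam
    simp only [gg]
    rw [integral_const_mul]
  have hpt : ∀ (lam : Fin m → ℝ) (x₁ x₂ : ℝ),
      (EV c j k).indicator (fun l => ENNReal.ofReal (goeDensity (m + 2) l))
        (j.insertNth x₂ (k.insertNth x₁ lam : Fin (m + 1) → ℝ) : Fin (m + 2) → ℝ) =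
      ENNReal.ofReal (goeDensity m lam) *
       (if ∃ i, lam i < x₁ ∧ x₁ < x₂ ∧ x₂ < lam i + c ∧ ∀ k, ¬ (lam i < lam k ∧ lam k < x₂) then
        ENNReal.ofReal (|x₁ - x₂| * ((∏ i, |x₁ - lam i|) * Real.exp (-(1/2) * x₁ ^ 2))
          * ((∏ i, |x₂ - lam i|) * Real.exp (-(1/2) * x₂ ^ 2))) else 0) := by
    intro lam x₁ x₂
    rw [Set.indicator_apply, mul_ite, mul_zero]
    have hmem : (j.insertNth x₂ (k.insertNth x₁ lam : Fin (m + 1) → ℝ) : Fin (m + 2) → ℝ) ∈ EV c j k ↔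
        ∃ i, lam i < x₁ ∧ x₁ < x₂ ∧ x₂ < lam i + c ∧ ∀ k, ¬ (lam i < lam k ∧ lam k < x₂) := by
      simp only [EV, gapCond, Set.mem_setOf_eq, Fin.insertNth_apply_same, Fin.insertNth_apply_succAbove]
    refine if_congr hmem ?_ rfl
    rw [← ENNReal.ofReal_mul (goe_nonneg _), goe_insert, goe_insert, Fin.prod_univ_succAbove _ k]
    simp only [Fin.insertNth_apply_same, Fin.insertNth_apply_succAbove]
    congr 1
    rw [abs_sub_comm x₂ x₁]
    ring
  calc _ ≤ ∫⁻ lam : Fin m → ℝ, ENNReal.ofReal (c ^ 4 / 4 * (2 * m + 1) * ∫ t, gg m (t, lam)) := by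
        refine lintegral_mono fun lam => ?_
        simp only [hpt]
        simp_rw [lintegral_const_mul' _ _ ENNReal.ofReal_ne_top]
        by_cases h : Function.Injective lam
        · refine (mul_le_mul_right (gap_bound lam h c hc) _).trans ?_
          rw [← ENNReal.ofReal_mul (goe_nonneg _), hG]
          refine ENNReal.ofReal_le_ofReal (le_of_eq ?_)
          ring
        · rw [goe_zero lam h]; simp
    _ = _ := by
        have hint := gg_int m
        rw [Measure.volume_eq_prod] at hint ⊢
        rw [integral_prod_symm _ hint, ← integral_const_mul, ofReal_integral_eq_lintegral_ofReal]
        · exact hint.integral_prod_right.const_mul _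
        · refine Filter.Eventually.of_forall fun lam => mul_nonneg hC (integral_nonneg fun t => ?_)
          exact mul_nonneg (goe_nonneg _) (mul_nonneg (sq_nonneg _) (Real.exp_pos _).le)

lemma main_lint {m : ℕ} (c₀ : ℝ) (hc : 0 < c₀) :
    ∫⁻ l in succGapEvent (m + 2) c₀, ENNReal.ofReal (goeDensity (m + 2) l) ≤
      ENNReal.ofReal ((m + 2) * (m + 1) * ((c₀ / ((m + 2 : ℕ) : ℝ)) ^ 4 / 4 * (2 * m + 1) * ∫ z, gg m z)) := by
  set c := c₀ / ((m + 2 : ℕ) : ℝ) with hcdef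
  have hcp : 0 < c := by rw [hcdef]; positivity
  set N : Set (Fin (m + 2) → ℝ) := {l | goeDensity (m + 2) l = 0} with hN
  have hNm : MeasurableSet N := (isClosed_eq (goe_cont _) continuous_const).measurableSet
  have hsub : succGapEvent (m + 2) c₀ ⊆ N ∪ ⋃ jk : Fin (m + 2) × Fin (m + 1), EV c jk.1 jk.2 := by
    intro l hl
    by_cases h : Function.Injective l
    · obtain ⟨j, k, hjk⟩ := cover c₀ l h hl
      exact Or.inr (Set.mem_iUnion.2 ⟨(j, k), hjk⟩)
    · exact Or.inl (goe_zero l h)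
  have hgg : 0 ≤ ∫ z, gg m z := integral_nonneg fun z =>
    mul_nonneg (goe_nonneg _) (mul_nonneg (sq_nonneg _) (Real.exp_pos _).le)
  refine (lintegral_mono_set hsub).trans ((lintegral_union_le _ _ _).trans ?_)
  have h0 : ∫⁻ l in N, ENNReal.ofReal (goeDensity (m + 2) l) = 0 := by
    rw [setLIntegral_congr_fun hNm (g := fun _ => 0) (fun l hl => by
      have : goeDensity (m + 2) l = 0 := hl
      simp [this])]
    simp
  rw [h0, zero_add]
  refine (lintegral_iUnion_le _ _).trans ?_
  rw [tsum_fintype]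
  refine (Finset.sum_le_sum fun jk _ => EV_lint c hcp jk.1 jk.2).trans (le_of_eq ?_)
  rw [Finset.sum_const, nsmul_eq_mul]
  simp only [Finset.card_univ, Fintype.card_prod, Fintype.card_fin]
  rw [← ENNReal.ofReal_natCast, ← ENNReal.ofReal_mul (Nat.cast_nonneg _)]
  congr 1
  push_cast
  ring

/-- for GOE eigenvalues and `n > 2c₀² + 2`,
`ℙ(χ̃^{(n,2)}((0,c₀)) > 0) ≤ c₀⁴/(8n)`. -/
theorem stmt19 (n : ℕ) (c₀ : ℝ) (hc : 0 < c₀) (hn : 2 * c₀ ^ 2 + 2 < (n : ℝ)) :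
    (∫ lam in succGapEvent n c₀, goeDensity n lam) / (∫ lam : Fin n → ℝ, goeDensity n lam) ≤
      c₀ ^ 4 / (8 * n) := by
  have hn2 : 2 ≤ n := by
    have : (2:ℝ) < n := by nlinarith [sq_nonneg c₀]
    exact_mod_cast this.le
  obtain ⟨m, rfl⟩ : ∃ m, n = m + 2 := ⟨n - 2, by omega⟩
  have h := main_lint (m := m) c₀ hc
  rw [G_identity] at h
  set Z := ∫ lam : Fin (m + 2) → ℝ, goeDensity (m + 2) lam with hZ
  have hZ0 : 0 ≤ Z := integral_nonneg fun l => goe_nonneg l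
  have hr : (0:ℝ) ≤ c₀ ^ 4 / (8 * ((m + 2 : ℕ) : ℝ)) := by positivity
  refine div_le_of_le_mul₀ hZ0 hr ?_
  rw [integral_eq_lintegral_of_nonneg_ae (Filter.Eventually.of_forall fun l => goe_nonneg l)
    (goe_cont _).aestronglyMeasurable]
  have h1 := ENNReal.toReal_le_of_le_ofReal (by positivity) h
  refine h1.trans ?_
  rw [show ((m:ℝ) + 2) * (m + 1) * ((c₀ / ((m + 2 : ℕ) : ℝ)) ^ 4 / 4 * (2 * m + 1) * (Z / 4)) =
    (((m:ℝ) + 2) * (m + 1) * ((c₀ / ((m + 2 : ℕ) : ℝ)) ^ 4 / 4 * (2 * m + 1) / 4)) * Z by ring]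
  refine mul_le_mul_of_nonneg_right ?_ hZ0
  push_cast
  have hm : (0:ℝ) ≤ m := m.cast_nonneg
  have e : ((m:ℝ) + 2) * (m + 1) * ((c₀ / (m + 2)) ^ 4 / 4 * (2 * m + 1) / 4) =
      c₀ ^ 4 / (8 * (m + 2)) * ((m + 1) * (2 * m + 1) / (2 * (m + 2) ^ 2)) := by
    field_simp
    ring
  rw [e]
  refine mul_le_of_le_one_right (by positivity) ?_
  rw [div_le_one (by positivity)]
  nlinarith
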